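/- arXiv:1609.04961 — 5 statements merged into one kernel-verified Lean document; each statement's English description precedes it below -/
import Mathlib

section
/- Fix an integer d ≥ 1 and let (m_n)_{n∈ℕ} be a sequence of positive reals with m_n → ∞ and m_n/n → 0. For u > 0 set ρ_u = P(X > u a, Y > u b)/P(X > u a) and let ρ = a(1/a + 1/b − V(a,b)) be its limit as u → ∞. If ρ ≠ 1 and ρ ≠ 2a/b, then (n/m_n)^{d/2} (ρ_{m_n^d} − ρ) → 0 as n → ∞ if and only if n/m_n³ → 0 as n → ∞. -/
open Filter MeasureTheory
open scoped Topology

/-- The second-order Taylor coefficient of `t ↦ exp (-c t)` at zero. -/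
lemma tendsto_exp_neg_mul_second_order (c : ℝ) :
    Tendsto (fun t : ℝ => (Real.exp (-(c * t)) - 1 + c * t) / t ^ 2) (𝓝[>] 0) (𝓝 (c ^ 2 / 2)) := by
  have h := Real.exp_sub_sum_range_succ_isLittleO_pow 2
  have hc : Tendsto (fun t : ℝ => -(c * t)) (𝓝[>] 0) (𝓝 0) := by
    have : Continuous fun t : ℝ => -(c * t) := by fun_prop
    simpa using (this.tendsto 0).mono_left nhdsWithin_le_nhds
  have hO : (fun t : ℝ => (-(c * t)) ^ 2) =O[𝓝[>] 0] fun t : ℝ => t ^ 2 := by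
    have : (fun t : ℝ => (-(c * t)) ^ 2) = fun t => c ^ 2 * t ^ 2 := by ext; ring
    rw [this]
    exact Asymptotics.isBigO_const_mul_self _ _ _
  have h2 := ((h.comp_tendsto hc).trans_isBigO hO).tendsto_div_nhds_zero
  have h3 := h2.add_const (c ^ 2 / 2)
  rw [zero_add] at h3
  refine h3.congr' ?_
  filter_upwards [self_mem_nhdsWithin] with t ht
  have ht : t ≠ 0 := ne_of_gt ht
  simp only [Function.comp_apply, Finset.sum_range_succ, Finset.sum_range_zero, Nat.factorial]
  push_cast
  field_simp
  ring

/-- The first-order rate at which the conditional exceedance probability, written in the variable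
`t = 1 / u`, approaches its limit. -/
lemma tendsto_exceedance_ratio_rate {α : ℝ} (β v : ℝ) (hα : 0 < α) :
    Tendsto (fun t : ℝ =>
      ((1 - Real.exp (-(α * t)) - Real.exp (-(β * t)) + Real.exp (-(v * t))) /
        (1 - Real.exp (-(α * t))) - (α + β - v) / α) / t) (𝓝[>] 0)
      (𝓝 ((v - β) * (v + β - α) / (2 * α))) := by
  have hA := tendsto_exp_neg_mul_second_order α
  have hB := tendsto_exp_neg_mul_second_order β
  have hV := tendsto_exp_neg_mul_second_order v
  have ht : Tendsto (fun t : ℝ => t) (𝓝[>] 0) (𝓝 0) := nhdsWithin_le_nhds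
  have hnum := ((hV.sub hB).sub (hA.const_mul (1 - (α + β - v) / α)))
  have hden := (ht.mul hA).const_sub α
  have hq := hnum.div hden (by simpa using hα.ne')
  have e : (v ^ 2 / 2 - β ^ 2 / 2 - (1 - (α + β - v) / α) * (α ^ 2 / 2)) / (α - 0 * (α ^ 2 / 2)) =
      (v - β) * (v + β - α) / (2 * α) := by
    field_simp
    ring
  rw [e] at hq
  refine hq.congr' ?_
  filter_upwards [self_mem_nhdsWithin] with t ht
  have ht : 0 < t := ht
  have hD : 1 - Real.exp (-(α * t)) ≠ 0 := by
    have : Real.exp (-(α * t)) < 1 := Real.exp_lt_one_iff.2 (neg_lt_zero.2 (mul_pos hα ht))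
    linarith
  have hden' : α - t * ((Real.exp (-(α * t)) - 1 + α * t) / t ^ 2) =
      (1 - Real.exp (-(α * t))) / t := by
    field_simp
    ring
  simp only [Pi.div_apply]
  rw [hden']
  generalize Real.exp (-(α * t)) = A at hD ⊢
  field_simp
  ring

/-- Inclusion–exclusion for the joint exceedance probability. -/
lemma toReal_joint_exceedance {Ω : Type*} [MeasurableSpace Ω] (P : Measure Ω)
    [IsProbabilityMeasure P] {X Y : Ω → ℝ} (hX : Measurable X) (hY : Measurable Y) (x y : ℝ) :
    (P {ω | x < X ω ∧ y < Y ω}).toReal =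
      1 - (P {ω | X ω ≤ x}).toReal - (P {ω | Y ω ≤ y}).toReal +
        (P {ω | X ω ≤ x ∧ Y ω ≤ y}).toReal := by
  have mX : MeasurableSet {ω | X ω ≤ x} := measurableSet_le hX measurable_const
  have mY : MeasurableSet {ω | Y ω ≤ y} := measurableSet_le hY measurable_const
  have h1 : {ω | x < X ω ∧ y < Y ω} = ({ω | X ω ≤ x} ∪ {ω | Y ω ≤ y})ᶜ := by
    ext ω
    simp
  have h2 : {ω | X ω ≤ x ∧ Y ω ≤ y} = {ω | X ω ≤ x} ∩ {ω | Y ω ≤ y} := rfl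
  have h3 := measureReal_union_add_inter (μ := P) (s := {ω | X ω ≤ x}) mY
  have h4 := probReal_compl_eq_one_sub (μ := P) (mX.union mY)
  rw [h1, h2]
  simp only [measureReal_def] at h3 h4
  linarith

/-- A nonnegative sequence tends to zero iff any fixed positive power of it does. -/
lemma tendsto_rpow_zero_iff {ι : Type*} {l : Filter ι} {f : ι → ℝ} (hf : ∀ i, 0 ≤ f i) {p : ℝ}
    (hp : 0 < p) : Tendsto (fun i => f i ^ p) l (𝓝 0) ↔ Tendsto f l (𝓝 0) := by
  constructor
  · intro h
    have := h.rpow_const (p := p⁻¹) (Or.inr (inv_pos.2 hp).le)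
    rw [Real.zero_rpow (inv_pos.2 hp).ne'] at this
    exact this.congr fun i => Real.rpow_rpow_inv (hf i) hp.ne'
  · intro h
    simpa [Real.zero_rpow hp.ne'] using h.rpow_const (p := p) (Or.inr hp.le)

/-- A factor with a nonzero limit does not affect convergence to zero. -/
lemma tendsto_mul_zero_iff_of_tendsto_ne_zero {ι : Type*} {l : Filter ι} {f g : ι → ℝ} {K : ℝ}
    (hg : Tendsto g l (𝓝 K)) (hK : K ≠ 0) :
    Tendsto (fun i => f i * g i) l (𝓝 0) ↔ Tendsto f l (𝓝 0) := by
  constructor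
  · intro h
    have := h.div hg hK
    rw [zero_div] at this
    refine this.congr' ?_
    filter_upwards [hg.eventually_ne hK] with i hi
    exact mul_div_cancel_right₀ _ hi
  · intro h
    simpa using h.mul hg

/-- fix `d ≥ 1` and positive reals `m_n → ∞` with `m_n/n → 0`.
With `ρ_u = P(X > ua, Y > ub)/P(X > ua)` and limit `ρ = a(1/a + 1/b − V(a,b))`,
if `ρ ≠ 1` and `ρ ≠ 2a/b`, then
`(n/m_n)^{d/2} (ρ_{m_n^d} − ρ) → 0` iff `n/m_n³ → 0`. -/
theorem stmt2
    (Ω : Type) [MeasurableSpace Ω] (P : Measure Ω) [IsProbabilityMeasure P]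
    (X Y : Ω → ℝ) (hX : Measurable X) (hY : Measurable Y)
    (V : ℝ → ℝ → ℝ)
    (hVpos : ∀ x₁ x₂ : ℝ, 0 < x₁ → 0 < x₂ → 0 < V x₁ x₂)
    (hVcont : ContinuousOn (fun q : ℝ × ℝ => V q.1 q.2) (Set.Ioi 0 ×ˢ Set.Ioi 0))
    (hVhom : ∀ c x₁ x₂ : ℝ, 0 < c → 0 < x₁ → 0 < x₂ →
      V (c * x₁) (c * x₂) = V x₁ x₂ / c)
    (hFX : ∀ x : ℝ, 0 < x → (P {ω | X ω ≤ x}).toReal = Real.exp (-1 / x))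
    (hFY : ∀ x : ℝ, 0 < x → (P {ω | Y ω ≤ x}).toReal = Real.exp (-1 / x))
    (hJ : ∀ x₁ x₂ : ℝ, 0 < x₁ → 0 < x₂ →
      (P {ω | X ω ≤ x₁ ∧ Y ω ≤ x₂}).toReal = Real.exp (-(V x₁ x₂)))
    (a b : ℝ) (ha : 0 < a) (hb : 0 < b)
    (d : ℕ) (hd : 1 ≤ d)
    (m : ℕ → ℝ) (hmpos : ∀ n, 0 < m n)
    (hm : Tendsto m atTop atTop)
    (hmn : Tendsto (fun n : ℕ => m n / (n : ℝ)) atTop (𝓝 0))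
    (ρu : ℝ → ℝ)
    (hρu : ∀ u : ℝ, 0 < u → ρu u =
      (P {ω | u * a < X ω ∧ u * b < Y ω}).toReal / (P {ω | u * a < X ω}).toReal)
    (ρ : ℝ) (hρ : ρ = a * (1 / a + 1 / b - V a b))
    (hρ1 : ρ ≠ 1) (hρ2 : ρ ≠ 2 * a / b) :
    Tendsto (fun n : ℕ => ((n : ℝ) / m n) ^ ((d : ℝ) / 2) * (ρu ((m n) ^ d) - ρ))
        atTop (𝓝 0)
      ↔ Tendsto (fun n : ℕ => (n : ℝ) / (m n) ^ 3) atTop (𝓝 0) := by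
  have hE : ∀ u : ℝ, 0 < u → ρu u =
      (1 - Real.exp (-(a⁻¹ * u⁻¹)) - Real.exp (-(b⁻¹ * u⁻¹)) + Real.exp (-(V a b * u⁻¹))) /
        (1 - Real.exp (-(a⁻¹ * u⁻¹))) := by
    intro u hu
    have hua := mul_pos hu ha
    have hub := mul_pos hu hb
    have hD : (P {ω | u * a < X ω}).toReal = 1 - (P {ω | X ω ≤ u * a}).toReal := by
      have h := probReal_compl_eq_one_sub (μ := P)
        (measurableSet_le hX measurable_const : MeasurableSet {ω | X ω ≤ u * a})
      rw [← measureReal_def, ← measureReal_def, ← h]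
      congr 1
      ext ω
      simp
    rw [hρu u hu, hD, toReal_joint_exceedance P hX hY, hFX _ hua, hFY _ hub, hJ _ _ hua hub,
      hVhom u a b hu ha hb]
    have e1 : ∀ c : ℝ, -1 / (u * c) = -(c⁻¹ * u⁻¹) := fun c => by
      rw [div_eq_mul_inv, mul_inv]
      ring
    rw [e1, e1, div_eq_mul_inv (V a b)]
  have hρ' : ρ = (a⁻¹ + b⁻¹ - V a b) / a⁻¹ := by
    rw [hρ]
    field_simp
  have hK : (V a b - b⁻¹) * (V a b + b⁻¹ - a⁻¹) / (2 * a⁻¹) ≠ 0 := by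
    refine div_ne_zero (mul_ne_zero (fun h => hρ1 ?_) fun h => hρ2 ?_) (by positivity)
    · rw [hρ, sub_eq_zero.1 h]
      field_simp
      ring
    · have hV : V a b = a⁻¹ - b⁻¹ := by linarith
      rw [hρ, hV]
      field_simp
      ring
  have hu : Tendsto (fun n => ((m n) ^ d)⁻¹) atTop (𝓝[>] 0) :=
    tendsto_inv_atTop_nhdsGT_zero.comp ((tendsto_pow_atTop (by omega)).comp hm)
  have hg := (tendsto_exceedance_ratio_rate b⁻¹ (V a b) (inv_pos.2 ha)).comp hu
  have hd2 : (0 : ℝ) < (d : ℝ) / 2 := by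
    have : (0 : ℝ) < d := by exact_mod_cast hd
    linarith
  have hr : ∀ n : ℕ, 0 ≤ (n : ℝ) / (m n) ^ 3 := fun n =>
    div_nonneg n.cast_nonneg (pow_pos (hmpos n) 3).le
  refine Iff.trans (tendsto_congr fun n => ?_)
    ((tendsto_mul_zero_iff_of_tendsto_ne_zero hg hK).trans (tendsto_rpow_zero_iff hr hd2))
  have hpos := hmpos n
  have hmd : (0 : ℝ) < m n ^ d := pow_pos hpos d
  have hpow : ((m n) ^ 2) ^ ((d : ℝ) / 2) = m n ^ d := by
    rw [← Real.rpow_natCast, ← Real.rpow_mul hpos.le, ← Real.rpow_natCast (m n) d]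
    congr 1
    push_cast
    ring
  have hsplit : (n : ℝ) / m n = n / m n ^ 3 * m n ^ 2 := by
    field_simp
  rw [hsplit, Real.mul_rpow (hr n) (by positivity), hpow, hE _ hmd, hρ']
  simp only [Function.comp_apply, div_inv_eq_mul]
  ring
end

section
/- For all reals 0 < a₁ < a₂ < ∞ and 0 < b₁ < b₂ < ∞, lim_{u→∞} P(u a₁ < X < u a₂, u b₁ < Y < u b₂) / P(u a₁ < X < u a₂) = (a₁a₂/(a₂−a₁)) · ( −V(a₂,b₂) + V(a₂,b₁) + V(a₁,b₂) − V(a₁,b₁) ), where the limit is taken over real u → ∞. -/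
open Filter MeasureTheory
open scoped Topology

theorem tendsto_mul_comp_inv_atTop {f : ℝ → ℝ} {f' : ℝ} (hf : HasDerivAt f f' 0)
    (h0 : f 0 = 0) : Tendsto (fun u : ℝ => u * f u⁻¹) atTop (𝓝 f') := by
  have h := hf.tendsto_slope_zero_right.comp tendsto_inv_atTop_nhdsGT_zero
  simpa [Function.comp_def, h0] using h

theorem hasDerivAt_exp_neg_mul_zero (c : ℝ) :
    HasDerivAt (fun t : ℝ => Real.exp (-(c * t))) (-c) 0 := by
  simpa using ((hasDerivAt_id (0 : ℝ)).const_mul c).neg.exp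

theorem measure_eq_zero_of_cdf_continuousAt {Ω : Type*} [MeasurableSpace Ω] (P : Measure Ω)
    [IsFiniteMeasure P] {X : Ω → ℝ} (hX : Measurable X) {F : ℝ → ℝ} {x : ℝ}
    (hF : ∀ᶠ y in 𝓝 x, P.real {ω | X ω ≤ y} = F y) (hc : ContinuousAt F x) :
    P {ω | X ω = x} = 0 := by
  have hle : ∀ᶠ y in 𝓝[<] x, P.real {ω | X ω = x} ≤ F x - F y := by
    filter_upwards [hF.filter_mono nhdsWithin_le_nhds, self_mem_nhdsWithin] with y hy hyx
    have hyx : y < x := hyx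
    have hsub : {ω | X ω ≤ y} ⊆ {ω | X ω ≤ x} := fun ω h => le_trans h hyx.le
    rw [← hy, ← hF.self_of_nhds, ← measureReal_sdiff hsub (measurableSet_le hX measurable_const)]
    refine measureReal_mono fun ω (h : X ω = x) => ⟨h.le, fun h' => ?_⟩
    exact absurd h' (not_le.2 (h ▸ hyx))
  have hlim : Tendsto (fun y => F x - F y) (𝓝[<] x) (𝓝 0) := by
    simpa using (tendsto_const_nhds (x := F x)).sub (hc.tendsto.mono_left nhdsWithin_le_nhds)
  have h := ge_of_tendsto hlim hle
  exact (measureReal_eq_zero_iff).1 (le_antisymm h measureReal_nonneg)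

theorem measureReal_Ioc_inter_eq {Ω : Type*} [MeasurableSpace Ω] (P : Measure Ω)
    [IsFiniteMeasure P] {X : Ω → ℝ} (hX : Measurable X) {S : Set Ω} {a b : ℝ} (hab : a ≤ b) :
    P.real {ω | (a < X ω ∧ X ω ≤ b) ∧ ω ∈ S}
      = P.real {ω | X ω ≤ b ∧ ω ∈ S} - P.real {ω | X ω ≤ a ∧ ω ∈ S} := by
  have h := measureReal_inter_add_sdiff (μ := P) (s := {ω | X ω ≤ b ∧ ω ∈ S})
    (measurableSet_le hX (measurable_const (a := a)))
  have e1 : {ω | X ω ≤ b ∧ ω ∈ S} ∩ {ω | X ω ≤ a} = {ω | X ω ≤ a ∧ ω ∈ S} := by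
    ext ω
    simp only [Set.mem_inter_iff, Set.mem_ofPred_eq]
    exact ⟨fun h => ⟨h.2, h.1.2⟩, fun h => ⟨⟨h.1.trans hab, h.2⟩, h.1⟩⟩
  have e2 : {ω | X ω ≤ b ∧ ω ∈ S} \ {ω | X ω ≤ a} = {ω | (a < X ω ∧ X ω ≤ b) ∧ ω ∈ S} := by
    ext ω
    simp only [Set.mem_sdiff, Set.mem_ofPred_eq, not_le]
    tauto
  rw [e1, e2] at h
  linarith

theorem measureReal_rectangle_eq {Ω : Type*} [MeasurableSpace Ω] (P : Measure Ω)
    [IsFiniteMeasure P] {X Y : Ω → ℝ} (hX : Measurable X) (hY : Measurable Y)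
    {a b c d : ℝ} (hab : a ≤ b) (hcd : c ≤ d) :
    P.real {ω | (a < X ω ∧ X ω ≤ b) ∧ (c < Y ω ∧ Y ω ≤ d)}
      = P.real {ω | X ω ≤ b ∧ Y ω ≤ d} - P.real {ω | X ω ≤ b ∧ Y ω ≤ c}
        - (P.real {ω | X ω ≤ a ∧ Y ω ≤ d} - P.real {ω | X ω ≤ a ∧ Y ω ≤ c}) := by
  have hy (x : ℝ) : P.real {ω | X ω ≤ x ∧ (c < Y ω ∧ Y ω ≤ d)}
      = P.real {ω | X ω ≤ x ∧ Y ω ≤ d} - P.real {ω | X ω ≤ x ∧ Y ω ≤ c} := by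
    have h := measureReal_Ioc_inter_eq P hY (S := {ω | X ω ≤ x}) hcd
    simpa only [Set.mem_ofPred_eq, and_comm (b := X _ ≤ x)] using h
  rw [← hy, ← hy]
  exact measureReal_Ioc_inter_eq P hX (S := {ω | c < Y ω ∧ Y ω ≤ d}) hab

/-- for a pair `(X,Y)` with standard unit Fréchet margins and joint
cdf `exp(−V(x₁,x₂))` (with `V` continuous and homogeneous of order −1), for all
`0 < a₁ < a₂ < ∞` and `0 < b₁ < b₂ < ∞`,
`lim_{u→∞} P(ua₁ < X < ua₂, ub₁ < Y < ub₂)/P(ua₁ < X < ua₂)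
  = (a₁a₂/(a₂−a₁)) (−V(a₂,b₂) + V(a₂,b₁) + V(a₁,b₂) − V(a₁,b₁))`. -/
theorem stmt6
    (Ω : Type) [MeasurableSpace Ω] (P : Measure Ω) [IsProbabilityMeasure P]
    (X Y : Ω → ℝ) (hX : Measurable X) (hY : Measurable Y)
    (V : ℝ → ℝ → ℝ)
    (hVpos : ∀ x₁ x₂ : ℝ, 0 < x₁ → 0 < x₂ → 0 < V x₁ x₂)
    (hVcont : ContinuousOn (fun q : ℝ × ℝ => V q.1 q.2) (Set.Ioi 0 ×ˢ Set.Ioi 0))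
    (hVhom : ∀ c x₁ x₂ : ℝ, 0 < c → 0 < x₁ → 0 < x₂ →
      V (c * x₁) (c * x₂) = V x₁ x₂ / c)
    (hFX : ∀ x : ℝ, 0 < x → (P {ω | X ω ≤ x}).toReal = Real.exp (-1 / x))
    (hFY : ∀ x : ℝ, 0 < x → (P {ω | Y ω ≤ x}).toReal = Real.exp (-1 / x))
    (hJ : ∀ x₁ x₂ : ℝ, 0 < x₁ → 0 < x₂ →
      (P {ω | X ω ≤ x₁ ∧ Y ω ≤ x₂}).toReal = Real.exp (-(V x₁ x₂)))
    (a₁ a₂ b₁ b₂ : ℝ) (ha₁ : 0 < a₁) (ha : a₁ < a₂) (hb₁ : 0 < b₁) (hb : b₁ < b₂) :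
    Tendsto (fun u : ℝ =>
        (P {ω | (u * a₁ < X ω ∧ X ω < u * a₂) ∧ (u * b₁ < Y ω ∧ Y ω < u * b₂)}).toReal
          / (P {ω | u * a₁ < X ω ∧ X ω < u * a₂}).toReal)
      atTop
      (𝓝 ((a₁ * a₂ / (a₂ - a₁))
        * (-(V a₂ b₂) + V a₂ b₁ + V a₁ b₂ - V a₁ b₁))) := by
  have ha₂ := ha₁.trans ha
  have hb₂ := hb₁.trans hb
  have hne {Z : Ω → ℝ} (hZ : Measurable Z)
      (hFZ : ∀ x : ℝ, 0 < x → (P {ω | Z ω ≤ x}).toReal = Real.exp (-1 / x))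
      {x : ℝ} (hx : 0 < x) : ∀ᵐ ω ∂P, Z ω ≠ x := by
    have h0 := measure_eq_zero_of_cdf_continuousAt P hZ (F := fun y => Real.exp (-1 / y))
      ((eventually_gt_nhds hx).mono hFZ)
      ((continuousAt_const.div continuousAt_id hx.ne').rexp)
    simpa [ae_iff] using h0
  have hV {u x y : ℝ} (hu : 0 < u) (hx : 0 < x) (hy : 0 < y) :
      P.real {ω | X ω ≤ u * x ∧ Y ω ≤ u * y} = Real.exp (-(V x y * u⁻¹)) := by
    rw [← div_eq_mul_inv, ← hVhom u x y hu hx hy]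
    exact hJ _ _ (mul_pos hu hx) (mul_pos hu hy)
  have hM {u x : ℝ} (hu : 0 < u) (hx : 0 < x) :
      P.real {ω | X ω ≤ u * x} = Real.exp (-(x⁻¹ * u⁻¹)) := by
    rw [measureReal_def, hFX _ (mul_pos hu hx), ← mul_inv, mul_comm x u, neg_div, one_div]
  let N : ℝ → ℝ := fun t => Real.exp (-(V a₂ b₂ * t)) - Real.exp (-(V a₂ b₁ * t))
    - (Real.exp (-(V a₁ b₂ * t)) - Real.exp (-(V a₁ b₁ * t)))
  let D : ℝ → ℝ := fun t => Real.exp (-(a₂⁻¹ * t)) - Real.exp (-(a₁⁻¹ * t))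
  have hN := tendsto_mul_comp_inv_atTop (f := N)
    (((hasDerivAt_exp_neg_mul_zero (V a₂ b₂)).sub (hasDerivAt_exp_neg_mul_zero (V a₂ b₁))).sub
      ((hasDerivAt_exp_neg_mul_zero (V a₁ b₂)).sub (hasDerivAt_exp_neg_mul_zero (V a₁ b₁))))
    (by simp [N])
  have hD := tendsto_mul_comp_inv_atTop (f := D)
    ((hasDerivAt_exp_neg_mul_zero a₂⁻¹).sub (hasDerivAt_exp_neg_mul_zero a₁⁻¹)) (by simp [D])
  have hsub : a₂ - a₁ ≠ 0 := (sub_pos.2 ha).ne'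
  have hD0 : -a₂⁻¹ - -a₁⁻¹ = (a₂ - a₁) / (a₁ * a₂) := by
    field_simp
    ring
  have hlim := hN.div hD (by rw [hD0]; exact div_ne_zero hsub (mul_pos ha₁ ha₂).ne')
  have hval : (-V a₂ b₂ - -V a₂ b₁ - (-V a₁ b₂ - -V a₁ b₁)) / (-a₂⁻¹ - -a₁⁻¹)
      = (a₁ * a₂ / (a₂ - a₁)) * (-(V a₂ b₂) + V a₂ b₁ + V a₁ b₂ - V a₁ b₁) := by
    rw [hD0]
    field_simp
    ring
  rw [hval] at hlim
  refine hlim.congr' ?_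
  filter_upwards [eventually_gt_atTop 0] with u hu
  have hXne := hne hX hFX (mul_pos hu ha₂)
  have hYne := hne hY hFY (mul_pos hu hb₂)
  have hua : u * a₁ ≤ u * a₂ := by gcongr
  have hub : u * b₁ ≤ u * b₂ := by gcongr
  have hnum : P.real {ω | (u * a₁ < X ω ∧ X ω < u * a₂) ∧ (u * b₁ < Y ω ∧ Y ω < u * b₂)}
      = N u⁻¹ := by
    have hae : {ω | (u * a₁ < X ω ∧ X ω < u * a₂) ∧ (u * b₁ < Y ω ∧ Y ω < u * b₂)} =ᵐ[P]
        {ω | (u * a₁ < X ω ∧ X ω ≤ u * a₂) ∧ (u * b₁ < Y ω ∧ Y ω ≤ u * b₂)} := by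
      rw [eventuallyEq_set]
      filter_upwards [hXne, hYne] with ω h1 h2
      simp only [lt_iff_le_and_ne (b := u * a₂), lt_iff_le_and_ne (b := u * b₂)]
      tauto
    rw [measureReal_congr hae, measureReal_rectangle_eq P hX hY hua hub, hV hu ha₂ hb₂,
      hV hu ha₂ hb₁, hV hu ha₁ hb₂, hV hu ha₁ hb₁]
  have hden : P.real {ω | u * a₁ < X ω ∧ X ω < u * a₂} = D u⁻¹ := by
    have hae : {ω | u * a₁ < X ω ∧ X ω < u * a₂} =ᵐ[P]
        {ω | u * a₁ < X ω ∧ X ω ≤ u * a₂} := by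
      rw [eventuallyEq_set]
      filter_upwards [hXne] with ω h1
      simp only [lt_iff_le_and_ne (b := u * a₂)]
      tauto
    have h := measureReal_Ioc_inter_eq P hX (S := Set.univ) hua
    simp only [Set.mem_univ, and_true] at h
    rw [measureReal_congr hae, h, hM hu ha₂, hM hu ha₁]
  rw [← measureReal_def, ← measureReal_def, hnum, hden]
  exact mul_div_mul_left _ _ hu.ne'
end

section
/- For all reals a, b > 0, lim_{u→∞} P(X > u a, Y > u b) / P(X > u a) = a · (1/a + 1/b − V(a,b)), where the limit is taken over real u → ∞. -/
open Filter MeasureTheory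
open scoped Topology

/-- Rescaled tail of an exponential: `u (1 - exp (-(k / u))) → k` as `u → ∞`. -/
theorem tendsto_mul_one_sub_exp_neg_div (k : ℝ) :
    Tendsto (fun u : ℝ => u * (1 - Real.exp (-(k / u)))) atTop (𝓝 k) := by
  have hd : HasDerivAt (fun h : ℝ => 1 - Real.exp (-(k * h))) k 0 := by
    simpa using (((hasDerivAt_id (0 : ℝ)).const_mul k).neg.exp).const_sub 1
  have hlim := hd.tendsto_slope_zero_right.comp (tendsto_inv_atTop_nhdsGT_zero (𝕜 := ℝ))
  refine hlim.congr fun u => ?_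
  simp [div_eq_mul_inv]

/-- Inclusion–exclusion for the joint survival function of two real random variables. -/
theorem measureReal_lt_and_lt {Ω : Type*} [MeasurableSpace Ω] (P : Measure Ω)
    [IsProbabilityMeasure P] {X Y : Ω → ℝ} (hX : Measurable X) (hY : Measurable Y) (s t : ℝ) :
    P.real {ω | s < X ω ∧ t < Y ω} =
      1 - P.real {ω | X ω ≤ s} - P.real {ω | Y ω ≤ t} + P.real {ω | X ω ≤ s ∧ Y ω ≤ t} := by
  have hA : MeasurableSet {ω | X ω ≤ s} := hX measurableSet_Iic
  have hB : MeasurableSet {ω | Y ω ≤ t} := hY measurableSet_Iic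
  have hc : {ω | s < X ω ∧ t < Y ω} = ({ω | X ω ≤ s} ∪ {ω | Y ω ≤ t})ᶜ := by
    ext ω
    simp
  have hunion := measureReal_union_add_inter (μ := P) (s := {ω | X ω ≤ s}) hB
  rw [hc, probReal_compl_eq_one_sub (hA.union hB), Set.ofPred_and]
  linarith

/-- The survival function of a real random variable in terms of its distribution function. -/
theorem measureReal_lt_eq_one_sub {Ω : Type*} [MeasurableSpace Ω] (P : Measure Ω)
    [IsProbabilityMeasure P] {X : Ω → ℝ} (hX : Measurable X) (s : ℝ) :
    P.real {ω | s < X ω} = 1 - P.real {ω | X ω ≤ s} := by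
  have hA : MeasurableSet {ω | X ω ≤ s} := hX measurableSet_Iic
  have hc : {ω | s < X ω} = {ω | X ω ≤ s}ᶜ := by
    ext ω
    simp
  rw [hc, probReal_compl_eq_one_sub hA]

/-- for a pair `(X,Y)` with standard unit Fréchet margins and joint
cdf `exp(−V(x₁,x₂))` (with `V` continuous and homogeneous of order −1), for all
`a, b > 0`,
`lim_{u→∞} P(X > ua, Y > ub) / P(X > ua) = a (1/a + 1/b − V(a,b))`. -/
theorem stmt7
    (Ω : Type) [MeasurableSpace Ω] (P : Measure Ω) [IsProbabilityMeasure P]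
    (X Y : Ω → ℝ) (hX : Measurable X) (hY : Measurable Y)
    (V : ℝ → ℝ → ℝ)
    (hVpos : ∀ x₁ x₂ : ℝ, 0 < x₁ → 0 < x₂ → 0 < V x₁ x₂)
    (hVcont : ContinuousOn (fun q : ℝ × ℝ => V q.1 q.2) (Set.Ioi 0 ×ˢ Set.Ioi 0))
    (hVhom : ∀ c x₁ x₂ : ℝ, 0 < c → 0 < x₁ → 0 < x₂ →
      V (c * x₁) (c * x₂) = V x₁ x₂ / c)
    (hFX : ∀ x : ℝ, 0 < x → (P {ω | X ω ≤ x}).toReal = Real.exp (-1 / x))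
    (hFY : ∀ x : ℝ, 0 < x → (P {ω | Y ω ≤ x}).toReal = Real.exp (-1 / x))
    (hJ : ∀ x₁ x₂ : ℝ, 0 < x₁ → 0 < x₂ →
      (P {ω | X ω ≤ x₁ ∧ Y ω ≤ x₂}).toReal = Real.exp (-(V x₁ x₂)))
    (a b : ℝ) (ha : 0 < a) (hb : 0 < b) :
    Tendsto (fun u : ℝ =>
        (P {ω | u * a < X ω ∧ u * b < Y ω}).toReal / (P {ω | u * a < X ω}).toReal)
      atTop (𝓝 (a * (1 / a + 1 / b - V a b))) := by
  have hlim := (((tendsto_mul_one_sub_exp_neg_div (1 / a)).add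
    (tendsto_mul_one_sub_exp_neg_div (1 / b))).sub
    (tendsto_mul_one_sub_exp_neg_div (V a b))).div
    (tendsto_mul_one_sub_exp_neg_div (1 / a)) (one_div_pos.2 ha).ne'
  have hval : (1 / a + 1 / b - V a b) / (1 / a) = a * (1 / a + 1 / b - V a b) := by
    rw [div_div_eq_mul_div, div_one, mul_comm]
  rw [← hval]
  refine hlim.congr' ?_
  filter_upwards [eventually_gt_atTop 0] with u hu
  have hua := mul_pos hu ha
  have hub := mul_pos hu hb
  have hnum := measureReal_lt_and_lt P hX hY (u * a) (u * b)
  have hden := measureReal_lt_eq_one_sub P hX (u * a)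
  simp only [measureReal_def] at hnum hden
  have hexp : ∀ c : ℝ, -1 / (u * c) = -(1 / c / u) := fun c => by
    rw [div_div, mul_comm c u, neg_div]
  rw [hnum, hden, hFX _ hua, hFY _ hub, hJ _ _ hua hub, hVhom u a b hu ha hb, hexp, hexp,
    Pi.div_apply, ← mul_add, ← mul_sub, mul_div_mul_left _ _ hu.ne']
  congr 1
  ring
end

section
/- Fix 0 < a₁ < a₂ < ∞ and 0 < b₁ < b₂ < ∞. For u > 0 set ρ_u = P(u a₁ < X < u a₂, u b₁ < Y < u b₂)/P(u a₁ < X < u a₂), and let ρ = (a₁a₂/(a₂−a₁))(−V(a₂,b₂) + V(a₂,b₁) + V(a₁,b₂) − V(a₁,b₁)) be its limit as u → ∞. Then lim_{u→∞} u·(ρ_u − ρ) exists and equals (a₁a₂/(2(a₂−a₁))) · [ V(a₂,b₂)² − V(a₂,b₁)² − V(a₁,b₂)² + V(a₁,b₁)² + (1/a₁ + 1/a₂)·(−V(a₂,b₂) + V(a₂,b₁) + V(a₁,b₂) − V(a₁,b₁)) ]; in particular, ρ_u = ρ + O(1/u) as u → ∞. -/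
open Filter MeasureTheory Asymptotics
open scoped Topology

/-- Second-order expansion of `exp (-(c / u))` as `u → ∞`. -/
theorem tendsto_sq_mul_exp_neg_div (c : ℝ) :
    Tendsto (fun u : ℝ => u ^ 2 * (Real.exp (-(c / u)) - 1 + c / u)) atTop (𝓝 (c ^ 2 / 2)) := by
  have h0 : Tendsto (fun u : ℝ => -(c / u)) atTop (𝓝 0) := by
    simpa using (tendsto_const_nhds (x := c)).div_atTop tendsto_id |>.neg
  have h1 := (Real.exp_sub_sum_range_succ_isLittleO_pow 2).comp_tendsto h0
  have h2 : (fun u : ℝ => (-(c / u)) ^ 2) =O[atTop] fun u : ℝ => (u ^ 2)⁻¹ := by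
    refine IsBigO.of_bound (c ^ 2) (Eventually.of_forall fun u => ?_)
    simp [div_eq_mul_inv, mul_pow]
  have h3 := (h1.trans_isBigO h2).tendsto_div_nhds_zero
  have h4 := h3.add_const (c ^ 2 / 2)
  rw [zero_add] at h4
  refine h4.congr' ?_
  filter_upwards [eventually_gt_atTop 0] with u hu
  simp only [Function.comp, Finset.sum_range_succ, Finset.sum_range_zero]
  norm_num [Nat.factorial]
  field_simp
  ring

/-- A real random variable whose distribution function agrees with a continuous function
on the positive half-line has no atom there. -/
theorem ae_ne_of_continuousAt_cdf {Ω : Type*} [MeasurableSpace Ω] {P : Measure Ω}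
    [IsFiniteMeasure P] {X : Ω → ℝ} (hX : Measurable X) {F : ℝ → ℝ}
    (hF : ∀ x : ℝ, 0 < x → P.real {ω | X ω ≤ x} = F x) {x : ℝ} (hx : 0 < x)
    (hFx : ContinuousAt F x) : ∀ᵐ ω ∂P, X ω ≠ x := by
  have hle : ∀ᶠ y in 𝓝[<] x, P.real {ω | X ω = x} ≤ F x - F y := by
    filter_upwards [self_mem_nhdsWithin, nhdsWithin_le_nhds (lt_mem_nhds hx)] with y hy hy0
    have hy : y < x := hy
    have hsub : {ω | X ω ≤ y} ⊆ {ω | X ω ≤ x} := fun ω (h : X ω ≤ y) => h.trans hy.le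
    rw [← hF x hx, ← hF y hy0, ← measureReal_sdiff hsub
      (measurableSet_le hX measurable_const)]
    exact measureReal_mono fun ω (h : X ω = x) => ⟨h.le, by simpa [h] using hy⟩
  have hlim : Tendsto (fun y => F x - F y) (𝓝[<] x) (𝓝 0) := by
    simpa using (hFx.tendsto.mono_left nhdsWithin_le_nhds).const_sub (F x)
  have h0 : P.real {ω | X ω = x} = 0 := le_antisymm (ge_of_tendsto hlim hle) measureReal_nonneg
  rw [ae_iff]
  simpa using (measureReal_eq_zero_iff).1 h0

/-- The mass of an open strip whose upper end carries no atom. -/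
theorem measureReal_strip {Ω : Type*} [MeasurableSpace Ω] {P : Measure Ω} [IsFiniteMeasure P]
    {X : Ω → ℝ} (hX : Measurable X) {x₁ x₂ : ℝ} (hx : x₁ ≤ x₂) (hx₂ : ∀ᵐ ω ∂P, X ω ≠ x₂) :
    P.real {ω | x₁ < X ω ∧ X ω < x₂} = P.real {ω | X ω ≤ x₂} - P.real {ω | X ω ≤ x₁} := by
  have hsub : {ω | X ω ≤ x₁} ⊆ {ω | X ω ≤ x₂} := fun ω (h : X ω ≤ x₁) => h.trans hx
  rw [← measureReal_sdiff hsub (measurableSet_le hX measurable_const)]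
  refine measureReal_congr ?_
  filter_upwards [hx₂] with ω h
  apply propext
  change (x₁ < X ω ∧ X ω < x₂) ↔ (X ω ≤ x₂ ∧ ¬ X ω ≤ x₁)
  grind

/-- Inclusion-exclusion for an open rectangle whose upper edges carry no mass. -/
theorem measureReal_rectangle {Ω : Type*} [MeasurableSpace Ω] {P : Measure Ω}
    [IsFiniteMeasure P] {X Y : Ω → ℝ} (hX : Measurable X) (hY : Measurable Y)
    {x₁ x₂ y₁ y₂ : ℝ} (hx : x₁ ≤ x₂) (hy : y₁ ≤ y₂)
    (hx₂ : ∀ᵐ ω ∂P, X ω ≠ x₂) (hy₂ : ∀ᵐ ω ∂P, Y ω ≠ y₂) :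
    P.real {ω | (x₁ < X ω ∧ X ω < x₂) ∧ (y₁ < Y ω ∧ Y ω < y₂)} =
      P.real {ω | X ω ≤ x₂ ∧ Y ω ≤ y₂} - P.real {ω | X ω ≤ x₂ ∧ Y ω ≤ y₁}
        - (P.real {ω | X ω ≤ x₁ ∧ Y ω ≤ y₂} - P.real {ω | X ω ≤ x₁ ∧ Y ω ≤ y₁}) := by
  have hm (x y : ℝ) : MeasurableSet {ω | X ω ≤ x ∧ Y ω ≤ y} :=
    (measurableSet_le hX measurable_const).inter (measurableSet_le hY measurable_const)
  have hsub (x : ℝ) : {ω | X ω ≤ x ∧ Y ω ≤ y₁} ⊆ {ω | X ω ≤ x ∧ Y ω ≤ y₂} :=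
    fun ω h => ⟨h.1, h.2.trans hy⟩
  rw [← measureReal_sdiff (hsub x₂) (hm _ _), ← measureReal_sdiff (hsub x₁) (hm _ _),
    ← measureReal_sdiff _ ((hm _ _).diff (hm _ _))]
  · refine measureReal_congr ?_
    filter_upwards [hx₂, hy₂] with ω h h'
    apply propext
    change ((x₁ < X ω ∧ X ω < x₂) ∧ (y₁ < Y ω ∧ Y ω < y₂)) ↔
      ((X ω ≤ x₂ ∧ Y ω ≤ y₂) ∧ ¬ (X ω ≤ x₂ ∧ Y ω ≤ y₁)) ∧
        ¬ ((X ω ≤ x₁ ∧ Y ω ≤ y₂) ∧ ¬ (X ω ≤ x₁ ∧ Y ω ≤ y₁))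
    grind
  · rintro ω ⟨h, h'⟩
    change (X ω ≤ x₁ ∧ Y ω ≤ y₂) at h
    change ¬ (X ω ≤ x₁ ∧ Y ω ≤ y₁) at h'
    change (X ω ≤ x₂ ∧ Y ω ≤ y₂) ∧ ¬ (X ω ≤ x₂ ∧ Y ω ≤ y₁)
    grind

/-- First-order correction to the limit of a quotient whose numerator and denominator have
second-order expansions `s / u + p / u ^ 2` and `d / u + q / u ^ 2`. -/
theorem tendsto_mul_div_sub_div {N D : ℝ → ℝ} {s p d q : ℝ} (hd : d ≠ 0)
    (hN : Tendsto (fun u => u ^ 2 * (N u - s / u)) atTop (𝓝 p))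
    (hD : Tendsto (fun u => u ^ 2 * (D u - d / u)) atTop (𝓝 q)) :
    Tendsto (fun u => u * (N u / D u - s / d)) atTop (𝓝 ((p * d - s * q) / (d * d))) := by
  have hE : Tendsto (fun u => u * D u) atTop (𝓝 d) := by
    have h := (hD.mul tendsto_inv_atTop_zero).add_const d
    rw [mul_zero, zero_add] at h
    refine h.congr' ?_
    filter_upwards [eventually_gt_atTop 0] with u hu
    field_simp
    ring
  refine (((hN.mul_const d).sub (hD.const_mul s)).div (hE.mul_const d)
    (mul_ne_zero hd hd)).congr' ?_
  filter_upwards [eventually_gt_atTop 0, hE.eventually_ne hd] with u hu hne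
  have hDu : D u ≠ 0 := right_ne_zero_of_mul hne
  simp only [Pi.div_apply]
  field_simp
  ring

/-- with `ρ_u = P(ua₁ < X < ua₂, ub₁ < Y < ub₂)/P(ua₁ < X < ua₂)` and
limit `ρ = (a₁a₂/(a₂−a₁))(−V(a₂,b₂) + V(a₂,b₁) + V(a₁,b₂) − V(a₁,b₁))`,
`lim_{u→∞} u (ρ_u − ρ)` exists and equals
`(a₁a₂/(2(a₂−a₁))) [V(a₂,b₂)² − V(a₂,b₁)² − V(a₁,b₂)² + V(a₁,b₁)²
  + (1/a₁ + 1/a₂)(−V(a₂,b₂) + V(a₂,b₁) + V(a₁,b₂) − V(a₁,b₁))]`;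
in particular `ρ_u = ρ + O(1/u)` as `u → ∞`. -/
theorem stmt8
    (Ω : Type) [MeasurableSpace Ω] (P : Measure Ω) [IsProbabilityMeasure P]
    (X Y : Ω → ℝ) (hX : Measurable X) (hY : Measurable Y)
    (V : ℝ → ℝ → ℝ)
    (hVpos : ∀ x₁ x₂ : ℝ, 0 < x₁ → 0 < x₂ → 0 < V x₁ x₂)
    (hVcont : ContinuousOn (fun q : ℝ × ℝ => V q.1 q.2) (Set.Ioi 0 ×ˢ Set.Ioi 0))
    (hVhom : ∀ c x₁ x₂ : ℝ, 0 < c → 0 < x₁ → 0 < x₂ →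
      V (c * x₁) (c * x₂) = V x₁ x₂ / c)
    (hFX : ∀ x : ℝ, 0 < x → (P {ω | X ω ≤ x}).toReal = Real.exp (-1 / x))
    (hFY : ∀ x : ℝ, 0 < x → (P {ω | Y ω ≤ x}).toReal = Real.exp (-1 / x))
    (hJ : ∀ x₁ x₂ : ℝ, 0 < x₁ → 0 < x₂ →
      (P {ω | X ω ≤ x₁ ∧ Y ω ≤ x₂}).toReal = Real.exp (-(V x₁ x₂)))
    (a₁ a₂ b₁ b₂ : ℝ) (ha₁ : 0 < a₁) (ha : a₁ < a₂) (hb₁ : 0 < b₁) (hb : b₁ < b₂)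
    (ρu : ℝ → ℝ)
    (hρu : ∀ u : ℝ, 0 < u → ρu u =
      (P {ω | (u * a₁ < X ω ∧ X ω < u * a₂) ∧ (u * b₁ < Y ω ∧ Y ω < u * b₂)}).toReal
        / (P {ω | u * a₁ < X ω ∧ X ω < u * a₂}).toReal)
    (ρ : ℝ)
    (hρ : ρ = (a₁ * a₂ / (a₂ - a₁))
        * (-(V a₂ b₂) + V a₂ b₁ + V a₁ b₂ - V a₁ b₁)) :
    Tendsto (fun u : ℝ => u * (ρu u - ρ)) atTop
      (𝓝 ((a₁ * a₂ / (2 * (a₂ - a₁)))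
        * ((V a₂ b₂) ^ 2 - (V a₂ b₁) ^ 2 - (V a₁ b₂) ^ 2 + (V a₁ b₁) ^ 2
          + (1 / a₁ + 1 / a₂)
            * (-(V a₂ b₂) + V a₂ b₁ + V a₁ b₂ - V a₁ b₁)))) ∧
    (fun u : ℝ => ρu u - ρ) =O[atTop] fun u : ℝ => 1 / u := by
  have hc (x : ℝ) (hx : 0 < x) : ContinuousAt (fun x : ℝ => Real.exp (-1 / x)) x :=
    (continuousAt_const.div continuousAt_id hx.ne').rexp
  have ha₂ : 0 < a₂ := ha₁.trans ha
  have hb₂ : 0 < b₂ := hb₁.trans hb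
  have hJu (u x y : ℝ) (hu : 0 < u) (hx : 0 < x) (hy : 0 < y) :
      P.real {ω | X ω ≤ u * x ∧ Y ω ≤ u * y} = Real.exp (-(V x y / u)) := by
    rw [← hVhom u x y hu hx hy]
    exact hJ _ _ (mul_pos hu hx) (mul_pos hu hy)
  have hFu (u x : ℝ) (hu : 0 < u) (hx : 0 < x) :
      P.real {ω | X ω ≤ u * x} = Real.exp (-(1 / x / u)) := by
    rw [measureReal_def, hFX _ (mul_pos hu hx)]
    congr 1
    field_simp
  have key : ∀ u : ℝ, 0 < u → ρu u =
      (Real.exp (-(V a₂ b₂ / u)) - Real.exp (-(V a₂ b₁ / u))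
        - (Real.exp (-(V a₁ b₂ / u)) - Real.exp (-(V a₁ b₁ / u))))
      / (Real.exp (-(1 / a₂ / u)) - Real.exp (-(1 / a₁ / u))) := by
    intro u hu
    have hxu := ae_ne_of_continuousAt_cdf hX hFX (mul_pos hu ha₂) (hc _ (mul_pos hu ha₂))
    have hyu := ae_ne_of_continuousAt_cdf hY hFY (mul_pos hu hb₂) (hc _ (mul_pos hu hb₂))
    have hxle : u * a₁ ≤ u * a₂ := by gcongr
    have hyle : u * b₁ ≤ u * b₂ := by gcongr
    rw [hρu u hu, ← measureReal_def, ← measureReal_def,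
      measureReal_rectangle hX hY hxle hyle hxu hyu, measureReal_strip hX hxle hxu]
    simp only [hJu, hFu, hu, ha₁, ha₂, hb₁, hb₂]
  have hd : 1 / a₁ - 1 / a₂ ≠ 0 := (sub_pos.2 (one_div_lt_one_div_of_lt ha₁ ha)).ne'
  have hsub : a₂ - a₁ ≠ 0 := (sub_pos.2 ha).ne'
  have hN := ((tendsto_sq_mul_exp_neg_div (V a₂ b₂)).sub
    (tendsto_sq_mul_exp_neg_div (V a₂ b₁))).sub ((tendsto_sq_mul_exp_neg_div (V a₁ b₂)).sub
    (tendsto_sq_mul_exp_neg_div (V a₁ b₁)))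
  have hD := (tendsto_sq_mul_exp_neg_div (1 / a₂)).sub (tendsto_sq_mul_exp_neg_div (1 / a₁))
  have hlim := tendsto_mul_div_sub_div
    (N := fun u => Real.exp (-(V a₂ b₂ / u)) - Real.exp (-(V a₂ b₁ / u))
      - (Real.exp (-(V a₁ b₂ / u)) - Real.exp (-(V a₁ b₁ / u))))
    (D := fun u => Real.exp (-(1 / a₂ / u)) - Real.exp (-(1 / a₁ / u)))
    (s := -(V a₂ b₂) + V a₂ b₁ + V a₁ b₂ - V a₁ b₁) hd
    (hN.congr fun u => by ring) (hD.congr fun u => by ring)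
  have hρ' : ρ = (-(V a₂ b₂) + V a₂ b₁ + V a₁ b₂ - V a₁ b₁) / (1 / a₁ - 1 / a₂) := by
    rw [hρ]
    field_simp
  have hmain : Tendsto (fun u : ℝ => u * (ρu u - ρ)) atTop
      (𝓝 ((a₁ * a₂ / (2 * (a₂ - a₁)))
        * ((V a₂ b₂) ^ 2 - (V a₂ b₁) ^ 2 - (V a₁ b₂) ^ 2 + (V a₁ b₁) ^ 2
          + (1 / a₁ + 1 / a₂)
            * (-(V a₂ b₂) + V a₂ b₁ + V a₁ b₂ - V a₁ b₁)))) := by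
    convert hlim.congr' ?_ using 2
    · field_simp
      ring
    · filter_upwards [eventually_gt_atTop 0] with u hu
      rw [key u hu, hρ']
  refine ⟨hmain, ?_⟩
  refine ((isBigO_refl (fun u : ℝ => 1 / u) atTop).mul (hmain.isBigO_one ℝ)).congr' ?_ ?_
  · filter_upwards [eventually_gt_atTop 0] with u hu
    field_simp
  · simp
end

section
/- For every h ∈ ℤ^d, 2V₁ − V₂(h) = Σ_{s∈ℤ^d} min(φ^{‖s‖}, φ^{‖s+h‖}), and this quantity satisfies the bound 2V₁ − V₂(h) ≤ 2 · Σ_{s∈ℤ^d, 2‖s‖ ≥ ‖h‖} φ^{‖s‖}. -/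
/-- The sup-norm of a lattice point `z ∈ ℤ^d`: `‖z‖ = max_j |z_j| ∈ {0,1,2,…}`. -/
def supN {d : ℕ} (z : Fin d → ℤ) : ℕ := Finset.univ.sup fun i => (z i).natAbs

theorem summable_prod_apply_of_nonneg {α : Type*} {f : α → ℝ} (hf : Summable f)
    (hf₀ : ∀ a, 0 ≤ f a) (n : ℕ) : Summable fun z : Fin n → α => ∏ i, f (z i) := by
  induction n with
  | zero => exact Summable.of_finite
  | succ n ih =>
    have hmul := hf.mul_of_nonneg ih hf₀ fun z => Finset.prod_nonneg fun i _ => hf₀ (z i)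
    rw [← (Fin.consEquiv fun _ => α).summable_iff]
    refine hmul.congr fun p => ?_
    simp [Fin.consEquiv, Fin.prod_univ_succ]

theorem summable_pow_natAbs {r : ℝ} (hr₀ : 0 ≤ r) (hr₁ : r < 1) :
    Summable fun n : ℤ => r ^ n.natAbs := by
  have hgeom := summable_geometric_of_lt_one hr₀ hr₁
  apply Summable.of_nat_of_neg <;> simpa using hgeom

theorem Summable.comp_add_right {G : Type*} [AddGroup G] {f : G → ℝ} (hf : Summable f) (h : G) :
    Summable fun s => f (s + h) :=
  (Equiv.addRight h).summable_iff.2 hf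

theorem tsum_comp_add_right {G : Type*} [AddGroup G] (f : G → ℝ) (h : G) :
    ∑' s, f (s + h) = ∑' s, f s :=
  (Equiv.addRight h).tsum_eq f

theorem natAbs_le_supN {d : ℕ} (z : Fin d → ℤ) (i : Fin d) : (z i).natAbs ≤ supN z :=
  Finset.le_sup (f := fun i => (z i).natAbs) (Finset.mem_univ i)

theorem supN_le_supN_add_supN_add {d : ℕ} (s h : Fin d → ℤ) :
    supN h ≤ supN s + supN (s + h) := by
  refine Finset.sup_le fun i _ => ?_
  have h₁ := natAbs_le_supN s i
  have h₂ := natAbs_le_supN (s + h) i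
  rw [Pi.add_apply] at h₂
  omega

theorem summable_pow_supN {d : ℕ} (hd : 1 ≤ d) {φ : ℝ} (hφ₀ : 0 < φ) (hφ₁ : φ < 1) :
    Summable fun z : Fin d → ℤ => φ ^ supN z := by
  have hd₀ : d ≠ 0 := by omega
  obtain ⟨r, hr₀, rfl⟩ : ∃ r : ℝ, 0 ≤ r ∧ r ^ d = φ :=
    ⟨φ ^ ((d : ℝ)⁻¹), by positivity, Real.rpow_inv_natCast_pow hφ₀.le hd₀⟩
  have hr₁ : r < 1 := (pow_lt_one_iff_of_nonneg hr₀ hd₀).1 hφ₁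
  refine (summable_prod_apply_of_nonneg (summable_pow_natAbs hr₀ hr₁) (fun _ => by positivity)
    d).of_nonneg_of_le (fun _ => by positivity) fun z => ?_
  rw [Finset.prod_pow_eq_pow_sum, ← pow_mul]
  refine pow_le_pow_of_le_one hr₀ hr₁.le ?_
  simpa using Finset.sum_le_card_nsmul Finset.univ (fun i => (z i).natAbs) (supN z)
    fun i _ => natAbs_le_supN z i

/-- with `V₁ = Σ_z φ^‖z‖` and `V₂(h) = Σ_s max(φ^‖s‖, φ^‖s+h‖)`
(sup-norm on `ℤ^d`, `φ ∈ (0,1)`), one has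
`2V₁ − V₂(h) = Σ_s min(φ^‖s‖, φ^‖s+h‖)` and
`2V₁ − V₂(h) ≤ 2 Σ_{s : 2‖s‖ ≥ ‖h‖} φ^‖s‖`. -/
theorem stmt16 (d : ℕ) (hd : 1 ≤ d) (φ : ℝ) (hφ : φ ∈ Set.Ioo (0 : ℝ) 1)
    (h : Fin d → ℤ) :
    (2 * (∑' z : Fin d → ℤ, φ ^ supN z)
        - (∑' s : Fin d → ℤ, max (φ ^ supN s) (φ ^ supN (s + h)))
      = ∑' s : Fin d → ℤ, min (φ ^ supN s) (φ ^ supN (s + h))) ∧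
    2 * (∑' z : Fin d → ℤ, φ ^ supN z)
        - (∑' s : Fin d → ℤ, max (φ ^ supN s) (φ ^ supN (s + h)))
      ≤ 2 * ∑' s : {s : Fin d → ℤ // supN h ≤ 2 * supN s}, φ ^ supN s.1 := by
  obtain ⟨hφ₀, hφ₁⟩ := hφ
  have hs := summable_pow_supN hd hφ₀ hφ₁
  have hs' : Summable fun s : Fin d → ℤ => φ ^ supN (s + h) :=
    hs.comp_add_right h
  have hshift : ∑' s : Fin d → ℤ, φ ^ supN (s + h) = ∑' z : Fin d → ℤ, φ ^ supN z :=
    tsum_comp_add_right (fun z => φ ^ supN z) h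
  have hmax : Summable fun s : Fin d → ℤ => max (φ ^ supN s) (φ ^ supN (s + h)) :=
    (hs.add hs').of_nonneg_of_le (fun s => by positivity) fun s =>
      max_le_add_of_nonneg (by positivity) (by positivity)
  have hmin : Summable fun s : Fin d → ℤ => min (φ ^ supN s) (φ ^ supN (s + h)) :=
    hs.of_nonneg_of_le (fun s => by positivity) fun s => min_le_left _ _
  have heq : 2 * (∑' z : Fin d → ℤ, φ ^ supN z)
      - (∑' s : Fin d → ℤ, max (φ ^ supN s) (φ ^ supN (s + h)))
      = ∑' s : Fin d → ℤ, min (φ ^ supN s) (φ ^ supN (s + h)) := by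
    rw [sub_eq_iff_eq_add, ← hmin.tsum_add hmax]
    simp_rw [min_add_max]
    rw [hs.tsum_add hs', hshift, two_mul]
  refine ⟨heq, ?_⟩
  rw [heq]
  let A : Set (Fin d → ℤ) := {s | supN h ≤ 2 * supN s}
  let g : (Fin d → ℤ) → ℝ := A.indicator fun s => φ ^ supN s
  have hgs : Summable g := hs.indicator A
  have hgs' : Summable fun s => g (s + h) := hgs.comp_add_right h
  have hgshift : ∑' s, g (s + h) = ∑' s, g s := tsum_comp_add_right g h
  have hg₀ : ∀ s, 0 ≤ g s := Set.indicator_nonneg fun s _ => by positivity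
  have hgA : ∀ s ∈ A, g s = φ ^ supN s := fun s hsA => Set.indicator_of_mem hsA _
  have hsub : ∑' s : {s : Fin d → ℤ // supN h ≤ 2 * supN s}, φ ^ supN s.1 = ∑' s, g s :=
    tsum_subtype A fun s => φ ^ supN s
  rw [hsub, two_mul]
  nth_rewrite 2 [← hgshift]
  rw [← hgs.tsum_add hgs']
  refine Summable.tsum_le_tsum (fun s => ?_) hmin (hgs.add hgs')
  rcases le_total (supN (s + h)) (supN s) with hle | hle
  · have hsA : s ∈ A := by
      have := supN_le_supN_add_supN_add s h
      change supN h ≤ 2 * supN s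
      omega
    rw [hgA s hsA]
    exact (min_le_left _ _).trans (le_add_of_nonneg_right (hg₀ _))
  · have hsA : s + h ∈ A := by
      have := supN_le_supN_add_supN_add s h
      change supN h ≤ 2 * supN (s + h)
      omega
    rw [hgA (s + h) hsA]
    exact (min_le_right _ _).trans (le_add_of_nonneg_left (hg₀ _))
end
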